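/- Let 1 ≤ n' < n and let τ1, τ2 : (Fin n' → Ω) → {C,D} be deterministic memory-n' strategies forming a mutual reinforcement learning equilibrium at memory length n': there exist Q1, Q2 : {C,D} × (Fin n' → Ω) → ℝ such that Q1 satisfies the player-1 memory-n' Bellman optimality equation against τ2 with τ1 strictly greedy for Q1, and Q2 satisfies the player-2 memory-n' Bellman optimality equation against τ1 with τ2 strictly greedy for Q2. Then the lifted memory-n strategies τ̂a(h) := τa(h↾n') (a = 1,2) form a mutual reinforcement learning equilibrium at memory length n: there exist Q̂1, Q̂2 : {C,D} × (Fin n → Ω) → ℝ such that Q̂1 satisfies the player-1 memory-n Bellman optimality equation against τ̂2 with τ̂1 strictly greedy for Q̂1, and Q̂2 satisfies the player-2 memory-n Bellman optimality equation against τ̂1 with τ̂2 strictly greedy for Q̂2. -/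

import Mathlib

inductive Act where
  | C : Act
  | D : Act
deriving DecidableEq

open Act

abbrev St : Type := Act × Act

/-- Player 1's payoff in the prisoner's dilemma. -/
def r1 (R S T P : ℝ) : Act → Act → ℝ
  | C, C => R
  | C, D => S
  | D, C => T
  | D, D => P

/-- Prepend the new state `(σ, σ2)` to a memory-`n` history, discarding the oldest state. -/
def push {n : ℕ} (σ σ2 : Act) (h : Fin n → St) : Fin n → St := fun i =>
  if (i : ℕ) = 0 then (σ, σ2)
  else h ⟨(i : ℕ) - 1, Nat.lt_of_le_of_lt (Nat.sub_le _ _) i.isLt⟩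

/-- Restrict a memory-`n` history to its `n'` most recent states (`n' ≤ n`). -/
def restrict {n n' : ℕ} (hle : n' ≤ n) (h : Fin n → St) : Fin n' → St := fun i =>
  h ⟨(i : ℕ), Nat.lt_of_lt_of_le i.isLt hle⟩

theorem restrict_push {n n' : ℕ} (hle : n' ≤ n) (σ σ2 : Act) (h : Fin n → St) :
    restrict hle (push σ σ2 h) = push σ σ2 (restrict hle h) := rfl

/-- a mutual reinforcement learning equilibrium of deterministic memory-`n'`
strategies remains a mutual reinforcement learning equilibrium when both players learn
memory-`n` strategies, `n > n'` (the strategies being lifted via restriction of histories). -/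
theorem stmt_14 (R S T P γ : ℝ) (hTR : T > R) (hRP : R > P) (hPS : P > S)
    (h2R : 2 * R > T + S) (hγ0 : 0 ≤ γ) (hγ1 : γ < 1)
    (n' n : ℕ) (hn' : 1 ≤ n') (hnn : n' < n)
    (τ1 τ2 : (Fin n' → St) → Act) (Q1 Q2 : Act → (Fin n' → St) → ℝ)
    (hQ1 : ∀ σ (g : Fin n' → St), Q1 σ g =
      r1 R S T P σ (τ2 g) +
        γ * max (Q1 C (push σ (τ2 g) g)) (Q1 D (push σ (τ2 g) g)))
    (hg1 : ∀ g : Fin n' → St, (τ1 g = C → Q1 C g > Q1 D g) ∧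
      (τ1 g = D → Q1 D g > Q1 C g))
    (hQ2 : ∀ σ (g : Fin n' → St), Q2 σ g =
      r1 R S T P σ (τ1 g) +
        γ * max (Q2 C (push (τ1 g) σ g)) (Q2 D (push (τ1 g) σ g)))
    (hg2 : ∀ g : Fin n' → St, (τ2 g = C → Q2 C g > Q2 D g) ∧
      (τ2 g = D → Q2 D g > Q2 C g)) :
    ∃ Q1' Q2' : Act → (Fin n → St) → ℝ,
      (∀ σ (h : Fin n → St), Q1' σ h =
        r1 R S T P σ (τ2 (restrict hnn.le h)) +
          γ * max (Q1' C (push σ (τ2 (restrict hnn.le h)) h))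
            (Q1' D (push σ (τ2 (restrict hnn.le h)) h))) ∧
      (∀ h : Fin n → St, (τ1 (restrict hnn.le h) = C → Q1' C h > Q1' D h) ∧
        (τ1 (restrict hnn.le h) = D → Q1' D h > Q1' C h)) ∧
      (∀ σ (h : Fin n → St), Q2' σ h =
        r1 R S T P σ (τ1 (restrict hnn.le h)) +
          γ * max (Q2' C (push (τ1 (restrict hnn.le h)) σ h))
            (Q2' D (push (τ1 (restrict hnn.le h)) σ h))) ∧
      (∀ h : Fin n → St, (τ2 (restrict hnn.le h) = C → Q2' C h > Q2' D h) ∧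
        (τ2 (restrict hnn.le h) = D → Q2' D h > Q2' C h)) := by
  refine ⟨fun σ h => Q1 σ (restrict hnn.le h), fun σ h => Q2 σ (restrict hnn.le h),
    fun σ h => ?_, fun h => hg1 _, fun σ h => ?_, fun h => hg2 _⟩
  · simp only [restrict_push]
    exact hQ1 σ _
  · simp only [restrict_push]
    exact hQ2 σ _
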